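/- Let E ⊆ ℂ^a ⊗ ℂ^b with codim(E_2) = 1, i.e., all 3×3 minors of the generic matrix of E share a nonconstant common factor, and suppose some matrix in E has rank ≥ 3. If an irreducible common factor P has degree 1, then the hyperplane {P = 0} ∩ E is a linear space of bounded rank 2; if P has degree 3, then after changes of bases E is contained in a 3×3 block ℂ³ ⊗ ℂ³. -/

import Mathlib

open MvPolynomial Matrix

/-- Three independent rows can be chosen in a matrix of rank at least three. -/
lemma exists_three_rows {m n : ℕ} (A : Matrix (Fin m) (Fin n) ℂ) (h : 3 ≤ A.rank) :
    ∃ f : Fin 3 → Fin m, (A.submatrix f id).rank = 3 := by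
  rw [rank_eq_finrank_span_row] at h
  obtain ⟨v, hv, -, hli⟩ := Submodule.exists_fun_fin_finrank_span_eq ℂ (Set.range A.row)
  choose w hw using hv
  refine ⟨fun k => w (Fin.castLE h k), ?_⟩
  have h3 : LinearIndependent ℂ (A.submatrix (fun k => w (Fin.castLE h k)) id).row := by
    have := hli.comp (Fin.castLE h) (Fin.castLE_injective h)
    have e : (A.submatrix (fun k => w (Fin.castLE h k)) id).row = v ∘ Fin.castLE h := by
      ext k j
      simp [← hw]
    rw [e]
    exact this
  simpa using h3.rank_matrix

lemma exists_minor {m n : ℕ} (A : Matrix (Fin m) (Fin n) ℂ) (h : 3 ≤ A.rank) :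
    ∃ (f : Fin 3 → Fin m) (g : Fin 3 → Fin n), (A.submatrix f g).det ≠ 0 := by
  obtain ⟨f, hf⟩ := exists_three_rows A h
  obtain ⟨g, hg⟩ := exists_three_rows (A.submatrix f id)ᵀ (by rw [rank_transpose, hf])
  refine ⟨f, g, ?_⟩
  have e : (A.submatrix f id)ᵀ.submatrix g id = (A.submatrix f g)ᵀ := rfl
  rw [e, rank_transpose] at hg
  have hli : LinearIndependent ℂ (A.submatrix f g).row := by
    rw [linearIndependent_iff_card_eq_finrank_span]
    rw [rank_eq_finrank_span_row] at hg
    simp [Set.finrank, hg]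
  have hu := Matrix.linearIndependent_rows_iff_isUnit.mp hli
  exact ((Matrix.isUnit_iff_isUnit_det _).mp hu).ne_zero

lemma det_zero_of_not_inj {R : Type*} [CommRing R] {m n : ℕ} (A : Matrix (Fin m) (Fin n) R)
    (f : Fin 3 → Fin m) (g : Fin 3 → Fin n)
    (h : ¬ (Function.Injective f ∧ Function.Injective g)) : (A.submatrix f g).det = 0 := by
  rw [not_and_or] at h
  rcases h with h | h
  · simp only [Function.Injective, not_forall] at h
    obtain ⟨i, j, hij, hne⟩ := h
    exact det_zero_of_row_eq hne (by ext k; simp [hij])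
  · simp only [Function.Injective, not_forall] at h
    obtain ⟨i, j, hij, hne⟩ := h
    exact det_zero_of_column_eq hne (by intro k; simp [hij])

lemma det_deg {c : ℕ} (M : Matrix (Fin 3) (Fin 3) (MvPolynomial (Fin c) ℂ))
    (h : ∀ i j, (M i j).IsHomogeneous 1) : M.det.IsHomogeneous 3 := by
  rw [det_fin_three]
  have h3 : ∀ i j k l m n, (M i j * M k l * M m n).IsHomogeneous 3 := fun i j k l m n =>
    ((h i j).mul (h k l)).mul (h m n)
  exact (((((h3 _ _ _ _ _ _).sub (h3 _ _ _ _ _ _)).sub (h3 _ _ _ _ _ _)).add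
    (h3 _ _ _ _ _ _)).add (h3 _ _ _ _ _ _)).sub (h3 _ _ _ _ _ _)

lemma scalar_of_dvd {c : ℕ} (P Q : MvPolynomial (Fin c) ℂ) (hP : P.totalDegree = 3)
    (hQ : Q.IsHomogeneous 3) (h : P ∣ Q) : ∃ u : ℂ, Q = C u * P := by
  obtain ⟨R, rfl⟩ := h
  by_cases hR : R = 0
  · exact ⟨0, by simp [hR]⟩
  have hP0 : P ≠ 0 := by rintro rfl; simp at hP
  have h1 := totalDegree_mul_of_isDomain hP0 hR
  have h2 := hQ.totalDegree_le
  have h3 : R.totalDegree = 0 := by omega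
  exact ⟨_, by rw [mul_comm]; congr 1; exact totalDegree_eq_zero_iff_eq_C.mp h3⟩

lemma col_comb {a b c : ℕ} (E : Matrix (Fin a) (Fin b) (MvPolynomial (Fin c) ℂ))
    (P : MvPolynomial (Fin c) ℂ) (hP : P ≠ 0) (f : Fin 3 → Fin a) (g : Fin 3 → Fin b)
    (u : ℂ) (hu : u ≠ 0) (hdet : (E.submatrix f g).det = C u * P) (j : Fin b)
    (h : ∀ k, ∃ v : ℂ, (E.submatrix f (Function.update g k j)).det = C v * P) :
    ∃ d : Fin 3 → ℂ, ∀ i, E (f i) j = ∑ k, E (f i) (g k) * C (d k) := by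
  choose v hv using h
  refine ⟨fun k => u⁻¹ * v k, fun i => ?_⟩
  have hc := congrFun (mulVec_cramer (E.submatrix f g) (fun i => E (f i) j)) i
  have hcr : ∀ k, cramer (E.submatrix f g) (fun i => E (f i) j) k = C (v k) * P := by
    intro k
    rw [cramer_apply, ← hv k]
    congr 1
    ext1 p q
    by_cases hq : q = k
    · subst hq; simp
    · simp [hq]
  simp only [mulVec, dotProduct, hcr, hdet, Pi.smul_apply, smul_eq_mul, submatrix_apply] at hc
  have h1 : C u * P ≠ 0 := mul_ne_zero (by simpa using hu) hP
  apply mul_left_cancel₀ h1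
  rw [← hc, Finset.mul_sum]
  refine Finset.sum_congr rfl fun k _ => ?_
  have h2 : C u * C (u⁻¹ * v k) = (C (v k) : MvPolynomial (Fin c) ℂ) := by
    rw [← C_mul, mul_inv_cancel_left₀ hu]
  rw [← h2]; ring

lemma bordered {R : Type*} [CommRing R] (M : Matrix (Fin 3) (Fin 3) R) (d e : Fin 3 → R) (l : R)
    (N : Fin 3 → Fin 3 → Matrix (Fin 3) (Fin 3) R)
    (hN : ∀ p q r s, N p q r s =
      if r = p then (if s = q then (∑ x, ∑ y, d x * M x y * e y) + l else ∑ x, d x * M x s)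
      else (if s = q then ∑ y, M r y * e y else M r s)) (p q : Fin 3) :
    (N p q).det = d p * e q * M.det + l * M.adjugate q p := by
  fin_cases p <;> fin_cases q <;>
  · simp [det_fin_three, hN, adjugate_fin_three, Fin.sum_univ_three]
    ring

lemma not_dvd_lin {c : ℕ} (P l : MvPolynomial (Fin c) ℂ) (hP : P.totalDegree = 3)
    (hl : l.IsHomogeneous 1) (h : P ∣ l) : l = 0 := by
  obtain ⟨R, rfl⟩ := h
  by_contra hn
  have h1 := totalDegree_mul_of_isDomain (left_ne_zero_of_mul hn) (right_ne_zero_of_mul hn)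
  have h2 := hl.totalDegree_le
  omega

/-- Setup of Section 3.3 of the paper: let `E` be a space of `a×b` matrices of linear
forms containing a matrix of rank `≥ 3`, and let `P` be an irreducible polynomial dividing
all `3×3` minors of `E` (so `codim E₂ = 1`). If `deg P = 1`, then the hyperplane
`{P = 0} ∩ E` has bounded rank `2`; if `deg P = 3`, then after changes of bases `E` is
contained in a `3×3` block `ℂ³ ⊗ ℂ³`. -/
theorem stmt19 (a b c : ℕ)
    (E : Matrix (Fin a) (Fin b) (MvPolynomial (Fin c) ℂ))
    (hlin : ∀ i j, (E i j).IsHomogeneous 1)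
    (hnb : ∃ x : Fin c → ℂ, 3 ≤ (E.map (MvPolynomial.eval x)).rank)
    (P : MvPolynomial (Fin c) ℂ) (hirr : Irreducible P)
    (hdvd : ∀ (f : Fin 3 → Fin a) (g : Fin 3 → Fin b),
      Function.Injective f → Function.Injective g → P ∣ (E.submatrix f g).det) :
    (P.totalDegree = 1 → ∀ x : Fin c → ℂ, MvPolynomial.eval x P = 0 →
      (E.map (MvPolynomial.eval x)).rank ≤ 2) ∧
    (P.totalDegree = 3 →
      ∃ (A' : Submodule ℂ (Fin a → ℂ)) (B' : Submodule ℂ (Fin b → ℂ)),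
        Module.finrank ℂ A' = 3 ∧ Module.finrank ℂ B' = 3 ∧
        ∀ x : Fin c → ℂ,
          (∀ j, (fun i => MvPolynomial.eval x (E i j)) ∈ A') ∧
          (∀ i, (fun j => MvPolynomial.eval x (E i j)) ∈ B')) := by
  have hall : ∀ (f : Fin 3 → Fin a) (g : Fin 3 → Fin b), P ∣ (E.submatrix f g).det := by
    intro f g
    by_cases h : Function.Injective f ∧ Function.Injective g
    · exact hdvd f g h.1 h.2
    · rw [det_zero_of_not_inj E f g h]; exact dvd_zero _
  have hev : ∀ (x : Fin c → ℂ) (f : Fin 3 → Fin a) (g : Fin 3 → Fin b),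
      ((E.map (eval x)).submatrix f g).det = eval x (E.submatrix f g).det := by
    intro x f g
    rw [RingHom.map_det]; rfl
  constructor
  · intro _ x hx
    by_contra hr
    obtain ⟨f, g, hfg⟩ := exists_minor (E.map (eval x)) (by omega)
    apply hfg
    obtain ⟨R, hR⟩ := hall f g
    rw [hev, hR, map_mul, hx, zero_mul]
  · intro hdeg
    have hP0 : P ≠ 0 := hirr.ne_zero
    have hpr : Prime P := hirr.prime
    obtain ⟨x₀, hx₀⟩ := hnb
    obtain ⟨f, g, hfg⟩ := exists_minor _ hx₀
    have hsc : ∀ (f : Fin 3 → Fin a) (g : Fin 3 → Fin b), ∃ u : ℂ,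
        (E.submatrix f g).det = C u * P := fun f g =>
      scalar_of_dvd P _ hdeg (det_deg _ fun i j => hlin _ _) (hall f g)
    obtain ⟨u, hu⟩ := hsc f g
    have hu0 : u ≠ 0 := by
      rintro rfl
      apply hfg
      rw [hev, hu]; simp
    choose e he using fun j => col_comb E P hP0 f g u hu0 hu j (fun k => hsc _ _)
    have hrow : ∀ i, ∃ d : Fin 3 → ℂ, ∀ j, Eᵀ (g j) i = ∑ k, Eᵀ (g j) (f k) * C (d k) := by
      intro i
      refine col_comb Eᵀ P hP0 g f u hu0 ?_ i (fun k => ?_)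
      · rw [← transpose_submatrix, det_transpose, hu]
      · rw [← transpose_submatrix, det_transpose]; exact hsc _ _
    choose d hd using hrow
    simp only [transpose_apply] at hd
    -- the key factorization
    have key : ∀ i j, E i j = ∑ x, ∑ y, C (d i x) * E (f x) (g y) * C (e j y) := by
      intro i j
      set l := E i j - ∑ x, ∑ y, C (d i x) * E (f x) (g y) * C (e j y) with hl
      have hlh : l.IsHomogeneous 1 := by
        refine (hlin i j).sub (IsHomogeneous.sum _ _ _ fun x _ => IsHomogeneous.sum _ _ _ fun y _ => ?_)
        simpa using ((isHomogeneous_C _ _).mul (hlin (f x) (g y))).mul (isHomogeneous_C _ (e j y))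
      suffices hl0 : l = 0 from sub_eq_zero.mp hl0
      have hb := bordered (E.submatrix f g) (fun x => C (d i x)) (fun y => C (e j y)) l
        (fun p q => E.submatrix (Function.update f p i) (Function.update g q j)) (by
          intro p q r s
          by_cases hr : r = p <;> by_cases hs : s = q
          · subst hr hs; simp [hl]
          · subst hr; simp [hs, hd i s, mul_comm]
          · subst hs; simp [hr, he j r]
          · simp [hr, hs])
      have hdv : ∀ p q, P ∣ l * (E.submatrix f g).adjugate q p := by
        intro p q
        have h1 := hall (Function.update f p i) (Function.update g q j)
        have h2 := hb p q
        rw [h2] at h1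
        exact (dvd_add_right (Dvd.dvd.mul_left (hall f g) _)).mp h1
      by_contra hl0
      have hadj : ∀ q p, P ∣ (E.submatrix f g).adjugate q p := fun q p =>
        (hpr.dvd_or_dvd (hdv p q)).resolve_left fun h => hl0 (not_dvd_lin P l hdeg hlh h)
      choose B hB using hadj
      have hBm : (E.submatrix f g).adjugate = P • Matrix.of B := by
        ext1 q p
        simp [hB]
      have h1 := det_adjugate (E.submatrix f g)
      rw [hBm, det_smul, hu] at h1
      simp only [Fintype.card_fin] at h1
      have h2 : P ^ 2 * (P * (Matrix.of B).det) = P ^ 2 * C (u ^ 2) := by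
        rw [C_pow]; linear_combination h1
      have h3 := mul_left_cancel₀ (pow_ne_zero 2 hP0) h2
      apply hirr.not_isUnit
      refine isUnit_of_dvd_unit ⟨_, h3.symm⟩ ?_
      exact (IsUnit.mk0 (u ^ 2) (pow_ne_zero 2 hu0)).map C
    set D : Matrix (Fin a) (Fin 3) ℂ := Matrix.of d with hD
    set F : Matrix (Fin b) (Fin 3) ℂ := Matrix.of e with hF
    have keyx : ∀ x : Fin c → ℂ,
        E.map (eval x) = D * ((E.map (eval x)).submatrix f g * Fᵀ) := by
      intro x
      ext i j
      simp only [map_apply, mul_apply, submatrix_apply, transpose_apply, hD, hF, of_apply]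
      rw [key i j]
      simp [Finset.mul_sum, mul_assoc]
    have rD : D.rank = 3 := by
      apply le_antisymm D.rank_le_width
      refine hx₀.trans ?_
      rw [keyx x₀]; exact rank_mul_le_left _ _
    have rF : F.rank = 3 := by
      apply le_antisymm F.rank_le_width
      refine hx₀.trans ?_
      rw [keyx x₀, ← Matrix.mul_assoc, ← rank_transpose F]; exact rank_mul_le_right _ _
    refine ⟨LinearMap.range D.mulVecLin, LinearMap.range F.mulVecLin, rD, rF, fun x => ⟨?_, ?_⟩⟩
    · intro j
      refine ⟨fun k => ((E.map (eval x)).submatrix f g * Fᵀ) k j, ?_⟩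
      ext i
      have := congrFun (congrFun (keyx x) i) j
      rw [map_apply] at this
      rw [this]; rfl
    · intro i
      refine ⟨fun k => (D * (E.map (eval x)).submatrix f g) i k, ?_⟩
      ext j
      have := congrFun (congrFun (keyx x) i) j
      rw [map_apply, ← Matrix.mul_assoc] at this
      rw [this, mulVecLin_apply, mulVec, dotProduct_comm]; rfl
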